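/- Let H be a Hilbert space admitting a nontrivial twisted Hilbert space (one in which the subspace copy of K is not complemented). Then the set L(H) of liftable operators on H is a proper two-sided ideal of B(H); in particular, the identity of H is not liftable. -/

import Mathlib

structure QuasiNormOn (X : Type) [AddCommGroup X] [Module ℂ X] where
  q : X → ℝ
  k : ℝ
  one_le_k : 1 ≤ k
  nonneg : ∀ x, 0 ≤ q x
  eq_zero_iff : ∀ x, q x = 0 ↔ x = 0
  smul_eq : ∀ (a : ℂ) (x : X), q (a • x) = ‖a‖ * q x
  tri : ∀ x y, q (x + y) ≤ k * (q x + q y)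

/-- A twisted Hilbert space over `H`: a short exact sequence
`0 → K → T → H → 0` of quasi-Banach spaces in which `K` and `H` are
Hilbert spaces. -/
structure TwistedHilbert (H K : Type)
    [NormedAddCommGroup H] [InnerProductSpace ℂ H] [CompleteSpace H]
    [NormedAddCommGroup K] [InnerProductSpace ℂ K] [CompleteSpace K] where
  T : Type
  [addT : AddCommGroup T]
  [modT : Module ℂ T]
  qT : QuasiNormOn T
  incl : K →ₗ[ℂ] T
  proj : T →ₗ[ℂ] H
  incl_bound : ∃ C : ℝ, ∀ y, qT.q (incl y) ≤ C * ‖y‖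
  incl_lower : ∃ c : ℝ, 0 < c ∧ ∀ y, c * ‖y‖ ≤ qT.q (incl y)
  proj_bound : ∃ C : ℝ, ∀ z, ‖proj z‖ ≤ C * qT.q z
  proj_surj : Function.Surjective proj
  exact : ∀ z, proj z = 0 ↔ z ∈ LinearMap.range incl
  complete : ∀ z : ℕ → T,
    (∀ ε : ℝ, 0 < ε → ∃ N, ∀ m, N ≤ m → ∀ n, N ≤ n → qT.q (z m - z n) ≤ ε) →
    ∃ l, ∀ ε : ℝ, 0 < ε → ∃ N, ∀ n, N ≤ n → qT.q (z n - l) ≤ ε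

attribute [instance] TwistedHilbert.addT TwistedHilbert.modT

/-- An operator `f ∈ B(H)` is liftable if for every twisted Hilbert space
`0 → K → T →π H → 0` there is a bounded operator `F : H → T` with `π ∘ F = f`. -/
def Liftable {H : Type} [NormedAddCommGroup H] [InnerProductSpace ℂ H]
    [CompleteSpace H] (f : H →L[ℂ] H) : Prop :=
  ∀ (K : Type) [NormedAddCommGroup K] [InnerProductSpace ℂ K] [CompleteSpace K]
    (E : TwistedHilbert H K),
    ∃ F : H →ₗ[ℂ] E.T, (∃ C : ℝ, ∀ x, E.qT.q (F x) ≤ C * ‖x‖) ∧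
      E.proj.comp F = (f : H →ₗ[ℂ] H)

theorem exists_nonneg_bound {X : Type*} {p r : X → ℝ} (hr : ∀ x, 0 ≤ r x)
    (h : ∃ C : ℝ, ∀ x, p x ≤ C * r x) : ∃ C : ℝ, 0 ≤ C ∧ ∀ x, p x ≤ C * r x := by
  obtain ⟨C, hC⟩ := h
  exact ⟨|C|, abs_nonneg C, fun x =>
    (hC x).trans (mul_le_mul_of_nonneg_right (le_abs_self C) (hr x))⟩

namespace QuasiNormOn

variable {X : Type} [AddCommGroup X] [Module ℂ X] (Q : QuasiNormOn X)

theorem map_zero : Q.q 0 = 0 := (Q.eq_zero_iff 0).2 rfl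

theorem map_neg (x : X) : Q.q (-x) = Q.q x := by
  simpa using Q.smul_eq (-1) x

theorem sub_le (x y : X) : Q.q (x - y) ≤ Q.k * (Q.q x + Q.q y) := by
  simpa [sub_eq_add_neg, Q.map_neg] using Q.tri x (-y)

/-- The sum quasi-norm on the product of a quasi-normed space and a normed space, restricted
to a subspace. -/
def prodNorm {H : Type} [NormedAddCommGroup H] [NormedSpace ℂ H] (S : Submodule ℂ (X × H)) :
    QuasiNormOn S where
  q z := Q.q z.1.1 + ‖z.1.2‖
  k := Q.k
  one_le_k := Q.one_le_k
  nonneg z := add_nonneg (Q.nonneg _) (norm_nonneg _)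
  eq_zero_iff z := by
    rw [add_eq_zero_iff_of_nonneg (Q.nonneg _) (norm_nonneg _), Q.eq_zero_iff, norm_eq_zero,
      ← Submodule.coe_eq_zero, Prod.ext_iff]
    rfl
  smul_eq a z := by
    simp [Q.smul_eq, norm_smul, mul_add]
  tri x y := by
    have h₁ := Q.tri x.1.1 y.1.1
    have h₂ := norm_add_le x.1.2 y.1.2
    have h₃ := mul_le_mul_of_nonneg_right Q.one_le_k
      (add_nonneg (norm_nonneg x.1.2) (norm_nonneg y.1.2))
    simp only [Submodule.coe_add, Prod.fst_add, Prod.snd_add]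
    linarith

end QuasiNormOn

section

variable {H K : Type} [NormedAddCommGroup H] [InnerProductSpace ℂ H] [CompleteSpace H]
  [NormedAddCommGroup K] [InnerProductSpace ℂ K] [CompleteSpace K]

namespace TwistedHilbert

theorem proj_incl (E : TwistedHilbert H K) (y : K) : E.proj (E.incl y) = 0 :=
  (E.exact _).2 ⟨y, rfl⟩

theorem incl_injective (E : TwistedHilbert H K) : Function.Injective E.incl := by
  obtain ⟨c, hc, h⟩ := E.incl_lower
  refine (injective_iff_map_eq_zero _).2 fun y hy => ?_
  have hy' := h y
  rw [hy, E.qT.map_zero] at hy'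
  exact norm_le_zero_iff.1 (nonpos_of_mul_nonpos_right hy' hc)

/-- The graph `{(t, h) | π t = a h}` underlying the pullback of a twisted Hilbert space. -/
def pullbackSubmodule (E : TwistedHilbert H K) (a : H →L[ℂ] H) : Submodule ℂ (E.T × H) :=
  LinearMap.eqLocus (E.proj.comp (LinearMap.fst ℂ E.T H))
    ((a : H →ₗ[ℂ] H).comp (LinearMap.snd ℂ E.T H))

theorem mem_pullbackSubmodule (E : TwistedHilbert H K) (a : H →L[ℂ] H) (z : E.T × H) :
    z ∈ E.pullbackSubmodule a ↔ E.proj z.1 = a z.2 := Iff.rfl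

theorem pullback_complete (E : TwistedHilbert H K) (a : H →L[ℂ] H)
    (z : ℕ → E.pullbackSubmodule a)
    (hz : ∀ ε : ℝ, 0 < ε → ∃ N, ∀ m, N ≤ m → ∀ n, N ≤ n →
      (E.qT.prodNorm (E.pullbackSubmodule a)).q (z m - z n) ≤ ε) :
    ∃ l, ∀ ε : ℝ, 0 < ε → ∃ N, ∀ n, N ≤ n →
      (E.qT.prodNorm (E.pullbackSubmodule a)).q (z n - l) ≤ ε := by
  obtain ⟨t, ht⟩ := E.complete (fun n => (z n).1.1) fun ε hε =>
    (hz ε hε).imp fun N hN m hm n hn =>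
      (le_add_of_nonneg_right (norm_nonneg _)).trans (hN m hm n hn)
  have hcauchy : CauchySeq fun n => (z n).1.2 := by
    refine Metric.cauchySeq_iff.2 fun ε hε => ?_
    refine (hz (ε / 2) (half_pos hε)).imp fun N hN m hm n hn => ?_
    rw [dist_eq_norm]
    exact ((le_add_of_nonneg_left (E.qT.nonneg _)).trans (hN m hm n hn)).trans_lt
      (half_lt_self hε)
  obtain ⟨h, hh⟩ := cauchySeq_tendsto_of_complete hcauchy
  obtain ⟨C, hC₀, hC⟩ := exists_nonneg_bound E.qT.nonneg E.proj_bound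
  have hproj : Filter.Tendsto (fun n => E.proj (z n).1.1) Filter.atTop (nhds (E.proj t)) := by
    refine Metric.tendsto_atTop.2 fun ε hε => ?_
    refine (ht (ε / (C + 1)) (by positivity)).imp fun N hN n hn => ?_
    rw [dist_eq_norm, ← map_sub]
    calc ‖E.proj ((z n).1.1 - t)‖ ≤ C * E.qT.q ((z n).1.1 - t) := hC _
      _ ≤ C * (ε / (C + 1)) := mul_le_mul_of_nonneg_left (hN n hn) hC₀
      _ < (C + 1) * (ε / (C + 1)) := by
        have : 0 < ε / (C + 1) := by positivity
        linarith
      _ = ε := by field_simp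
  have hmem : E.proj t = a h :=
    tendsto_nhds_unique (hproj.congr fun n => (z n).2) ((a.continuous.tendsto h).comp hh)
  refine ⟨⟨(t, h), hmem⟩, fun ε hε => ?_⟩
  obtain ⟨N₁, hN₁⟩ := ht (ε / 2) (half_pos hε)
  obtain ⟨N₂, hN₂⟩ := Metric.tendsto_atTop.1 hh (ε / 2) (half_pos hε)
  refine ⟨max N₁ N₂, fun n hn => ?_⟩
  have h₁ := hN₁ n (le_of_max_le_left hn)
  have h₂ := hN₂ n (le_of_max_le_right hn)
  rw [dist_eq_norm] at h₂
  change E.qT.q ((z n).1.1 - t) + ‖(z n).1.2 - h‖ ≤ ε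
  linarith

/-- The pullback of a twisted Hilbert space `0 → K → T → H → 0` along an operator `a` on `H`. -/
def pullback (E : TwistedHilbert H K) (a : H →L[ℂ] H) : TwistedHilbert H K where
  T := E.pullbackSubmodule a
  qT := E.qT.prodNorm (E.pullbackSubmodule a)
  incl := ((LinearMap.inl ℂ E.T H).comp E.incl).codRestrict _ fun y => by
    simp [mem_pullbackSubmodule, E.proj_incl]
  proj := (LinearMap.snd ℂ E.T H).comp (E.pullbackSubmodule a).subtype
  incl_bound := E.incl_bound.imp fun C hC y => by
    change E.qT.q (E.incl y) + ‖(0 : H)‖ ≤ C * ‖y‖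
    simpa using hC y
  incl_lower := E.incl_lower.imp fun c hc => ⟨hc.1, fun y => by
    change c * ‖y‖ ≤ E.qT.q (E.incl y) + ‖(0 : H)‖
    simpa using hc.2 y⟩
  proj_bound := ⟨1, fun z => by
    simpa [QuasiNormOn.prodNorm] using E.qT.nonneg z.1.1⟩
  proj_surj h := by
    obtain ⟨t, ht⟩ := E.proj_surj (a h)
    exact ⟨⟨(t, h), ht⟩, rfl⟩
  exact z := by
    constructor
    · intro hz
      have hz₂ : z.1.2 = 0 := hz
      obtain ⟨y, hy⟩ := (E.exact z.1.1).1 (by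
        rw [(E.mem_pullbackSubmodule a z.1).1 z.2, hz₂, map_zero])
      exact ⟨y, Subtype.ext (Prod.ext hy hz₂.symm)⟩
    · rintro ⟨y, rfl⟩
      rfl
  complete := E.pullback_complete a

/-- A bounded linear section of the quotient map yields a bounded projection onto the subspace. -/
theorem exists_retraction_of_section (E : TwistedHilbert H K) (F : H →ₗ[ℂ] E.T)
    (hF : ∃ C : ℝ, ∀ x, E.qT.q (F x) ≤ C * ‖x‖) (hsec : E.proj.comp F = LinearMap.id) :
    ∃ G : E.T →ₗ[ℂ] K,
      (∃ C : ℝ, ∀ z, ‖G z‖ ≤ C * E.qT.q z) ∧ G.comp E.incl = LinearMap.id := by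
  obtain ⟨C, hC₀, hC⟩ := exists_nonneg_bound norm_nonneg hF
  obtain ⟨D, hD⟩ := E.proj_bound
  obtain ⟨c, hc₀, hc⟩ := E.incl_lower
  let R : E.T →ₗ[ℂ] LinearMap.range E.incl :=
    (LinearMap.id - F.comp E.proj).codRestrict _ fun z => by
      rw [← E.exact]
      have := LinearMap.congr_fun hsec (E.proj z)
      simp only [LinearMap.comp_apply, LinearMap.id_apply] at this
      simp [this]
  let e := LinearEquiv.ofInjective E.incl E.incl_injective
  have hG : ∀ z, E.incl (e.symm (R z)) = z - F (E.proj z) := fun z =>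
    congrArg Subtype.val (e.apply_symm_apply (R z))
  refine ⟨e.symm.toLinearMap.comp R, ⟨c⁻¹ * (E.qT.k * (1 + C * D)), fun z => ?_⟩, ?_⟩
  · have hk : 0 ≤ E.qT.k := zero_le_one.trans E.qT.one_le_k
    rw [mul_assoc, le_inv_mul_iff₀ hc₀]
    calc c * ‖e.symm (R z)‖ ≤ E.qT.q (z - F (E.proj z)) := hG z ▸ hc _
      _ ≤ E.qT.k * (E.qT.q z + E.qT.q (F (E.proj z))) := E.qT.sub_le _ _
      _ ≤ E.qT.k * (E.qT.q z + C * (D * E.qT.q z)) := by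
        gcongr
        exact (hC _).trans (mul_le_mul_of_nonneg_left (hD z) hC₀)
      _ = E.qT.k * (1 + C * D) * E.qT.q z := by ring
  · ext y
    apply E.incl_injective
    simp [hG, E.proj_incl]

end TwistedHilbert

namespace Liftable

theorem zero : Liftable (0 : H →L[ℂ] H) := by
  intro K _ _ _ E
  exact ⟨0, ⟨0, fun x => by simp [E.qT.map_zero]⟩, by ext; simp⟩

theorem add {f g : H →L[ℂ] H} (hf : Liftable f) (hg : Liftable g) : Liftable (f + g) := by
  intro K _ _ _ E
  obtain ⟨F, ⟨C, hC⟩, hF⟩ := hf K E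
  obtain ⟨G, ⟨D, hD⟩, hG⟩ := hg K E
  refine ⟨F + G, ⟨E.qT.k * (C + D), fun x => ?_⟩, ?_⟩
  · have hk : 0 ≤ E.qT.k := zero_le_one.trans E.qT.one_le_k
    calc E.qT.q (F x + G x) ≤ E.qT.k * (E.qT.q (F x) + E.qT.q (G x)) := E.qT.tri _ _
      _ ≤ E.qT.k * (C * ‖x‖ + D * ‖x‖) :=
        mul_le_mul_of_nonneg_left (add_le_add (hC x) (hD x)) hk
      _ = E.qT.k * (C + D) * ‖x‖ := by ring
  · rw [LinearMap.comp_add, hF, hG]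
    rfl

theorem comp_right {f : H →L[ℂ] H} (hf : Liftable f) (b : H →L[ℂ] H) :
    Liftable (f.comp b) := by
  intro K _ _ _ E
  obtain ⟨F, hbound, hF⟩ := hf K E
  obtain ⟨C, hC₀, hC⟩ := exists_nonneg_bound norm_nonneg hbound
  refine ⟨F.comp (b : H →ₗ[ℂ] H), ⟨C * ‖b‖, fun x => ?_⟩, ?_⟩
  · rw [mul_assoc]
    exact (hC (b x)).trans (mul_le_mul_of_nonneg_left (b.le_opNorm x) hC₀)
  · rw [← LinearMap.comp_assoc, hF]
    rfl

/-- Lift `f` to the pullback along `a` and project to the original twisted Hilbert space. -/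
theorem comp_left {f : H →L[ℂ] H} (hf : Liftable f) (a : H →L[ℂ] H) :
    Liftable (a.comp f) := by
  intro K _ _ _ E
  obtain ⟨F, ⟨C, hC⟩, hF⟩ := hf K (E.pullback a)
  let p : (E.pullback a).T →ₗ[ℂ] E.T :=
    (LinearMap.fst ℂ E.T H).comp (E.pullbackSubmodule a).subtype
  refine ⟨p.comp F, ⟨C, fun x => ?_⟩, ?_⟩
  · exact (le_add_of_nonneg_right (norm_nonneg _)).trans (hC x)
  · ext x
    have h₁ : E.proj (p (F x)) = a ((E.pullback a).proj (F x)) := (F x).2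
    have h₂ : (E.pullback a).proj (F x) = f x := LinearMap.congr_fun hF x
    exact h₁.trans (congrArg a h₂)

end Liftable

end

/-- if `H` admits a nontrivial twisted Hilbert space (one whose
subspace copy of `K` is not complemented, i.e. there is no bounded projection
`G : T → K` with `G ∘ ı = id`), then the liftable operators form a proper
two-sided ideal of `B(H)`; in particular the identity of `H` is not liftable. -/
theorem statement5 {H K : Type}
    [NormedAddCommGroup H] [InnerProductSpace ℂ H] [CompleteSpace H]
    [NormedAddCommGroup K] [InnerProductSpace ℂ K] [CompleteSpace K]
    (E : TwistedHilbert H K)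
    (hnontrivial : ¬ ∃ G : E.T →ₗ[ℂ] K,
      (∃ C : ℝ, ∀ z, ‖G z‖ ≤ C * E.qT.q z) ∧ G.comp E.incl = LinearMap.id) :
    Liftable (0 : H →L[ℂ] H) ∧
    (∀ f g : H →L[ℂ] H, Liftable f → Liftable g → Liftable (f + g)) ∧
    (∀ f a b : H →L[ℂ] H, Liftable f → Liftable (a.comp (f.comp b))) ∧
    ¬ Liftable (ContinuousLinearMap.id ℂ H) := by
  refine ⟨Liftable.zero, fun f g hf hg => hf.add hg,
    fun f a b hf => (hf.comp_right b).comp_left a, fun hid => hnontrivial ?_⟩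
  obtain ⟨F, hbound, hF⟩ := hid K E
  exact E.exists_retraction_of_section F hbound hF
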